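/- Assume the Goldberg–Seymour statement: every multigraph H with χ'(H) ≥ Δ(H)+2 satisfies χ'(H) = ⌈ρ(H)⌉. Assume also that for every edge-chromatic critical multigraph H with χ'(H) ≥ Δ(H)+2 and every edge e of H there is a proper edge (χ'(H)−1)-coloring of H−e under which V(H) is elementary. If G is a multigraph with χ'(G) ≥ Δ(G)+2 that has a spanning edge-chromatic critical subgraph H with χ'(H) = χ'(G), then χ''(G) = χ'(G). -/

import Mathlib

/-- A multigraph: a finite graph possibly with parallel edges but no loops.
Edges are abstract objects, each mapped to an unordered pair of distinct vertices. -/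
structure Multigraph where
  V : Type
  E : Type
  fintypeV : Fintype V
  fintypeE : Fintype E
  decEqV : DecidableEq V
  decEqE : DecidableEq E
  ends : E → Sym2 V
  loopless : ∀ e, ¬ (ends e).IsDiag

attribute [instance] Multigraph.fintypeV Multigraph.fintypeE
attribute [instance] Multigraph.decEqV Multigraph.decEqE

namespace Multigraph

variable (G : Multigraph)

/-- The degree of a vertex: the number of edges incident with it. -/
def degree (v : G.V) : ℕ :=
  (Finset.univ.filter fun e : G.E => v ∈ G.ends e).card

/-- The maximum degree Δ(G). -/
def maxDegree : ℕ :=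
  Finset.univ.sup G.degree

/-- A proper edge coloring with color set `Fin k`: edges sharing an endpoint
receive distinct colors. -/
def IsProperEdgeColoring {k : ℕ} (φ : G.E → Fin k) : Prop :=
  ∀ e f : G.E, e ≠ f → (∃ v, v ∈ G.ends e ∧ v ∈ G.ends f) → φ e ≠ φ f

/-- The chromatic index χ'(G): the least `k` admitting a proper edge `k`-coloring. -/
noncomputable def chromaticIndex : ℕ :=
  sInf {k | ∃ φ : G.E → Fin k, G.IsProperEdgeColoring φ}

/-- Two vertices are adjacent if some edge joins them. -/
def Adj (u v : G.V) : Prop := ∃ e, G.ends e = s(u, v)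

/-- A proper total coloring with color set `Fin k`: no two adjacent or incident
elements of `V(G) ∪ E(G)` receive the same color. -/
def IsProperTotalColoring {k : ℕ} (cV : G.V → Fin k) (cE : G.E → Fin k) : Prop :=
  G.IsProperEdgeColoring cE ∧
  (∀ u v : G.V, G.Adj u v → cV u ≠ cV v) ∧
  (∀ v e, v ∈ G.ends e → cV v ≠ cE e)

/-- The total chromatic number χ''(G): the least `k` admitting a proper total
`k`-coloring. -/
noncomputable def totalChromaticNumber : ℕ :=
  sInf {k | ∃ (cV : G.V → Fin k) (cE : G.E → Fin k), G.IsProperTotalColoring cV cE}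

/-- `H` is a subgraph of `G`: there are injections of the vertices and edges of `H`
into those of `G` preserving the incidence structure. -/
def IsSubgraph (H G : Multigraph) : Prop :=
  ∃ (f : H.V → G.V) (g : H.E → G.E),
    Function.Injective f ∧ Function.Injective g ∧
    ∀ e, G.ends (g e) = (H.ends e).map f

/-- `H` is a spanning subgraph of `G`: a subgraph whose vertex set is all of `V(G)`. -/
def IsSpanningSubgraph (H G : Multigraph) : Prop :=
  ∃ (f : H.V → G.V) (g : H.E → G.E),
    Function.Bijective f ∧ Function.Injective g ∧
    ∀ e, G.ends (g e) = (H.ends e).map f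

/-- `H` is a proper subgraph of `G`. -/
def IsProperSubgraph (H G : Multigraph) : Prop :=
  IsSubgraph H G ∧ ¬ IsSubgraph G H

/-- `G` is edge-chromatic critical: every proper subgraph has a smaller chromatic index. -/
def EdgeChromaticCritical (G : Multigraph) : Prop :=
  ∀ H : Multigraph, IsProperSubgraph H G → H.chromaticIndex < G.chromaticIndex

/-- The density ρ(G) = max{2|E(H)|/(|V(H)|−1) : H ⊆ G, |V(H)| ≥ 3 odd}
(0 if no such subgraph exists). -/
noncomputable def density (G : Multigraph) : ℝ :=
  sSup ({0} ∪ {q : ℝ | ∃ H : Multigraph, IsSubgraph H G ∧ Odd (Fintype.card H.V) ∧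
    3 ≤ Fintype.card H.V ∧
    q = 2 * (Fintype.card H.E : ℝ) / ((Fintype.card H.V : ℝ) - 1)})

/-- A subgraph of `G` given by a set of vertices and a set of edges of `G`
whose endpoints all lie in the chosen vertex set. -/
structure Sub (G : Multigraph) where
  verts : Finset G.V
  edges : Finset G.E
  support : ∀ e ∈ edges, ∀ v, v ∈ G.ends e → v ∈ verts

/-- A subgraph is `k`-dense if its order is odd and at least 3, and
`2|E(H)| = k(|V(H)|−1)`. -/
def Sub.IsDense {G : Multigraph} (S : G.Sub) (k : ℕ) : Prop :=
  Odd S.verts.card ∧ 3 ≤ S.verts.card ∧ 2 * S.edges.card = k * (S.verts.card - 1)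

/-- A subgraph is maximal `k`-dense if it is `k`-dense and no `k`-dense subgraph
contains it as a proper subgraph. -/
def Sub.MaximalDense {G : Multigraph} (S : G.Sub) (k : ℕ) : Prop :=
  S.IsDense k ∧ ∀ T : G.Sub, T.IsDense k → S.verts ⊆ T.verts → S.edges ⊆ T.edges →
    S.verts = T.verts ∧ S.edges = T.edges

/-- The set of colors of `Fin k` missing at `v` under the edge coloring `φ`. -/
def missing {k : ℕ} (φ : G.E → Fin k) (v : G.V) : Set (Fin k) :=
  {c | ∀ e : G.E, v ∈ G.ends e → φ e ≠ c}

/-- A vertex set `W` is elementary under `φ` if the sets of missing colors of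
distinct vertices of `W` are disjoint. -/
def Elementary {k : ℕ} (φ : G.E → Fin k) (W : Set G.V) : Prop :=
  ∀ u ∈ W, ∀ v ∈ W, u ≠ v → Disjoint (G.missing φ u) (G.missing φ v)

/-- An edge is a boundary edge of `W` if exactly one of its ends lies in `W`. -/
def IsBoundaryEdge (W : Set G.V) (e : G.E) : Prop :=
  ∃ a b, G.ends e = s(a, b) ∧ a ∈ W ∧ b ∉ W

/-- Deleting an edge from a multigraph. -/
def deleteEdge (G : Multigraph) (e : G.E) : Multigraph where
  V := G.V
  E := {f : G.E // f ≠ e}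
  fintypeV := G.fintypeV
  fintypeE := by classical exact inferInstance
  decEqV := G.decEqV
  decEqE := by classical exact inferInstance
  ends := fun f => G.ends f.1
  loopless := fun f => G.loopless f.1

/-- Adding a new edge joining two distinct vertices of a multigraph. -/
def addEdge (G : Multigraph) (u v : G.V) (huv : u ≠ v) : Multigraph where
  V := G.V
  E := Option G.E
  fintypeV := G.fintypeV
  fintypeE := inferInstance
  decEqV := G.decEqV
  decEqE := inferInstance
  ends := fun e => e.elim s(u, v) G.ends
  loopless := fun e => by
    cases e with
    | none => simpa using huv
    | some f => exact G.loopless f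

end Multigraph

open Multigraph

namespace Multigraph

/-- The two ends of an edge, as a finset. -/
def endFinset (G : Multigraph) (e : G.E) : Finset G.V := (G.ends e).toFinset

/-- The edges with both ends in `W`. -/
def innerEdges (G : Multigraph) (W : Finset G.V) : Finset G.E :=
  Finset.univ.filter fun e => G.endFinset e ⊆ W

section

variable {G : Multigraph}

lemma mem_endFinset {e : G.E} {v : G.V} : v ∈ G.endFinset e ↔ v ∈ G.ends e := by
  simp [endFinset]

lemma mem_innerEdges {e : G.E} {W : Finset G.V} :
    e ∈ G.innerEdges W ↔ G.endFinset e ⊆ W := by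
  simp [innerEdges]

lemma card_endFinset (e : G.E) : (G.endFinset e).card = 2 :=
  Sym2.card_toFinset_of_not_isDiag _ (G.loopless e)

lemma degree_le_maxDegree (v : G.V) : G.degree v ≤ G.maxDegree :=
  Finset.le_sup (f := G.degree) (Finset.mem_univ v)

lemma innerEdges_univ : G.innerEdges Finset.univ = Finset.univ := by
  ext; simp [mem_innerEdges]

lemma card_biUnion_endFinset_le (F : Finset G.E) :
    (F.biUnion G.endFinset).card ≤ 2 * F.card := by
  rw [mul_comm]
  exact Finset.card_biUnion_le_card_mul _ _ _ fun e _ => (card_endFinset e).le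

lemma card_biUnion_endFinset_color {k : ℕ} {φ : G.E → Fin k}
    (hφ : G.IsProperEdgeColoring φ) (S : Finset G.E) (c : Fin k) :
    ((S.filter fun e => φ e = c).biUnion G.endFinset).card
      = 2 * (S.filter fun e => φ e = c).card := by
  rw [Finset.card_biUnion]
  · simp [card_endFinset, mul_comm]
  · intro e he f hf hef
    simp only [Finset.mem_coe, Finset.mem_filter] at he hf
    refine Finset.disjoint_left.2 fun v hve hvf => ?_
    exact hφ e f hef ⟨v, mem_endFinset.1 hve, mem_endFinset.1 hvf⟩ (he.2.trans hf.2.symm)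

lemma card_color_innerEdges_le {k : ℕ} {φ : G.E → Fin k}
    (hφ : G.IsProperEdgeColoring φ) {W : Finset G.V} (hW : Odd W.card) (c : Fin k) :
    2 * ((G.innerEdges W).filter fun e => φ e = c).card ≤ W.card - 1 := by
  have h1 := card_biUnion_endFinset_color hφ (G.innerEdges W) c
  have h2 : ((G.innerEdges W).filter fun e => φ e = c).biUnion G.endFinset ⊆ W := by
    refine Finset.biUnion_subset.2 fun e he => ?_
    exact mem_innerEdges.1 (Finset.mem_filter.1 he).1
  have h3 := Finset.card_le_card h2
  obtain ⟨m, hm⟩ := hW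
  omega

lemma two_mul_card_innerEdges_le {k : ℕ} {φ : G.E → Fin k}
    (hφ : G.IsProperEdgeColoring φ) {W : Finset G.V} (hW : Odd W.card) :
    2 * (G.innerEdges W).card ≤ k * (W.card - 1) := by
  rw [Finset.card_eq_sum_card_fiberwise (f := φ) (t := Finset.univ) (by simp [Set.MapsTo]),
    Finset.mul_sum]
  calc _ ≤ ∑ _c : Fin k, (W.card - 1) :=
        Finset.sum_le_sum fun c _ => card_color_innerEdges_le hφ hW c
    _ = _ := by simp

lemma exists_missing {k : ℕ} (φ : G.E → Fin k) {v : G.V} (hv : G.degree v < k) :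
    ∃ c, c ∈ G.missing φ v := by
  have h : ((Finset.univ.filter fun e : G.E => v ∈ G.ends e).image φ).card
      < (Finset.univ : Finset (Fin k)).card := by
    refine Finset.card_image_le.trans_lt ?_
    simpa [degree] using hv
  obtain ⟨c, -, hc⟩ := Finset.exists_mem_notMem_of_card_lt_card h
  refine ⟨c, fun e he hec => hc ?_⟩
  exact Finset.mem_image.2 ⟨e, by simpa using he, hec⟩

lemma mem_missing_iff {k : ℕ} (φ : G.E → Fin k) (v : G.V) (c : Fin k) :
    c ∈ G.missing φ v ↔
      v ∉ (Finset.univ.filter fun e => φ e = c).biUnion G.endFinset := by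
  simp only [missing, Set.mem_ofPred_eq, Finset.mem_biUnion, Finset.mem_filter,
    Finset.mem_univ, true_and, mem_endFinset, not_exists, not_and]
  exact ⟨fun h e he hv => h e hv he, fun h e hv he => h e he hv⟩

lemma exists_coloring_of_chromaticIndex_le {k : ℕ} (h : G.chromaticIndex ≤ k) :
    ∃ φ : G.E → Fin k, G.IsProperEdgeColoring φ := by
  have hne : {k | ∃ φ : G.E → Fin k, G.IsProperEdgeColoring φ}.Nonempty :=
    ⟨Fintype.card G.E, Fintype.equivFin G.E, fun e f hef _ => by simpa using hef⟩
  obtain ⟨φ, hφ⟩ := Nat.sInf_mem hne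
  exact ⟨fun e => Fin.castLE h (φ e), fun e f hef hv => fun h' => hφ e f hef hv (Fin.castLE_injective h h')⟩

lemma chromaticIndex_le {k : ℕ} {φ : G.E → Fin k} (hφ : G.IsProperEdgeColoring φ) :
    G.chromaticIndex ≤ k :=
  Nat.sInf_le ⟨φ, hφ⟩

lemma exists_coloring_of_innerEdges_le
    (GS : ∀ H : Multigraph, H.maxDegree + 2 ≤ H.chromaticIndex →
      H.chromaticIndex = ⌈H.density⌉₊)
    {k : ℕ} (hdeg : ∀ v, G.degree v ≤ k)
    (hW : ∀ W : Finset G.V, Odd W.card → 2 * (G.innerEdges W).card ≤ (k + 1) * (W.card - 1)) :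
    ∃ φ : G.E → Fin (k + 1), G.IsProperEdgeColoring φ := by
  apply exists_coloring_of_chromaticIndex_le
  by_contra! hlt
  have hΔ : G.maxDegree ≤ k := Finset.sup_le fun v _ => hdeg v
  have hχ := GS G (by omega)
  have hρ : G.density ≤ (k + 1 : ℕ) := by
    refine csSup_le ⟨0, by simp⟩ ?_
    rintro q (rfl | ⟨H, ⟨f, g, hf, hg, hfg⟩, hodd, h3, rfl⟩)
    · positivity
    have hc : (Finset.univ.image f).card = Fintype.card H.V :=
      Finset.card_image_of_injective _ hf
    have h1 := hW (Finset.univ.image f) (by rwa [hc])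
    have h2 : Fintype.card H.E ≤ (G.innerEdges (Finset.univ.image f)).card := by
      rw [← Finset.card_univ, ← Finset.card_image_of_injective _ hg]
      refine Finset.card_le_card fun e' he' => ?_
      obtain ⟨e, -, rfl⟩ := Finset.mem_image.1 he'
      refine mem_innerEdges.2 fun v hv => ?_
      rw [mem_endFinset, hfg, Sym2.mem_map] at hv
      obtain ⟨w, -, rfl⟩ := hv
      simp
    rw [hc] at h1
    obtain ⟨m, hm⟩ : ∃ m, Fintype.card H.V = m + 1 := ⟨_, (Nat.succ_pred (by omega)).symm⟩
    rw [hm] at h1 h3 ⊢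
    have hm0 : (0 : ℝ) < m := by exact_mod_cast (by omega : 0 < m)
    rw [div_le_iff₀ (by push_cast; linarith)]
    have h4 : 2 * Fintype.card H.E ≤ (k + 1) * m := by simp at h1; omega
    have h5 : (2 * Fintype.card H.E : ℝ) ≤ (k + 1) * m := by exact_mod_cast h4
    push_cast
    linarith
  have := Nat.ceil_le.2 hρ
  omega

lemma sum_degree_eq (S : Finset G.V) :
    ∑ v ∈ S, G.degree v = ∑ e : G.E, (G.endFinset e ∩ S).card := by
  have h := Finset.sum_card_bipartiteAbove_eq_sum_card_bipartiteBelow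
    (s := S) (t := (Finset.univ : Finset G.E)) (fun v e => v ∈ G.endFinset e)
  simp only [Finset.bipartiteAbove, Finset.bipartiteBelow, mem_endFinset] at h
  unfold degree
  rw [h]
  refine Finset.sum_congr rfl fun e _ => congrArg _ ?_
  ext v
  simp [mem_endFinset, and_comm]

lemma card_innerEdges_add_le_sdiff (A B : Finset G.V) :
    (G.innerEdges A).card + (G.innerEdges B).card ≤
      (G.innerEdges (A \ B)).card + (G.innerEdges (B \ A)).card
        + ∑ v ∈ A ∩ B, G.degree v := by
  rw [sum_degree_eq]
  simp only [innerEdges, Finset.card_filter]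
  simp only [← Finset.sum_add_distrib]
  refine Finset.sum_le_sum fun e _ => ?_
  by_cases hA : G.endFinset e ⊆ A <;> by_cases hB : G.endFinset e ⊆ B
  · rw [Finset.inter_eq_left.2 (Finset.subset_inter hA hB), card_endFinset]
    simp [hA, hB]
  · by_cases h : G.endFinset e ⊆ A \ B
    · simp only [hA, hB, h, if_true, if_false]
      omega
    · have : (G.endFinset e ∩ (A ∩ B)).Nonempty := by
        obtain ⟨v, hv, hv'⟩ := Finset.not_subset.1 h
        have := hA hv
        exact ⟨v, by simp_all⟩
      have := this.card_pos
      simp only [hA, hB, if_true, if_false]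
      omega
  · by_cases h : G.endFinset e ⊆ B \ A
    · simp only [hA, hB, h, if_true, if_false]
      omega
    · have : (G.endFinset e ∩ (A ∩ B)).Nonempty := by
        obtain ⟨v, hv, hv'⟩ := Finset.not_subset.1 h
        have := hB hv
        exact ⟨v, by simp_all⟩
      have := this.card_pos
      simp only [hA, hB, if_true, if_false]
      omega
  · simp [hA, hB]

lemma card_innerEdges_add_le_union (A B : Finset G.V) :
    (G.innerEdges A).card + (G.innerEdges B).card ≤
      (G.innerEdges (A ∪ B)).card + (G.innerEdges (A ∩ B)).card := by
  rw [← Finset.card_union_add_card_inter]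
  refine add_le_add (Finset.card_le_card fun e => ?_) (Finset.card_le_card fun e => ?_)
  · simp only [Finset.mem_union, mem_innerEdges]
    rintro (h | h)
    · exact h.trans Finset.subset_union_left
    · exact h.trans Finset.subset_union_right
  · simp only [Finset.mem_inter, mem_innerEdges]
    exact fun h => Finset.subset_inter h.1 h.2

/-- An odd vertex set spanning as many edges as `k` near-perfect matchings. -/
def TightSet (G : Multigraph) (k : ℕ) (W : Finset G.V) : Prop :=
  Odd W.card ∧ 2 * (G.innerEdges W).card = k * (W.card - 1)

lemma TightSet.union {k : ℕ} (hdeg : ∀ v, G.degree v ≤ k)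
    (hG : ∀ W : Finset G.V, Odd W.card → 2 * (G.innerEdges W).card ≤ (k + 1) * (W.card - 1))
    {A B : Finset G.V} (hA : G.TightSet (k + 1) A) (hB : G.TightSet (k + 1) B)
    (hAB : (A ∩ B).Nonempty) : G.TightSet (k + 1) (A ∪ B) := by
  have hpos := hAB.card_pos
  have hunion := Finset.card_union_add_card_inter A B
  have hsA := Finset.card_sdiff_add_card_inter A B
  have hsB := Finset.card_sdiff_add_card_inter B A
  rw [Finset.inter_comm B A] at hsB
  obtain ⟨⟨a, ha⟩, eA⟩ := hA
  obtain ⟨⟨b, hb⟩, eB⟩ := hB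
  rcases Nat.even_or_odd (A ∩ B).card with ⟨i, hi⟩ | ⟨i, hi⟩
  · exfalso
    obtain ⟨c, hc⟩ : ∃ c, (A \ B).card = 2 * c + 1 := ⟨a - i, by omega⟩
    obtain ⟨d, hd⟩ : ∃ d, (B \ A).card = 2 * d + 1 := ⟨b - i, by omega⟩
    have h1 := hG _ ⟨c, hc⟩
    have h2 := hG _ ⟨d, hd⟩
    have h3 := card_innerEdges_add_le_sdiff A B
    have h4 : ∑ v ∈ A ∩ B, G.degree v ≤ (i + i) * k := by
      rw [← hi, ← smul_eq_mul]
      exact Finset.sum_le_card_nsmul _ _ _ fun v _ => hdeg v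
    obtain rfl : a = c + i := by omega
    obtain rfl : b = d + i := by omega
    rw [ha, Nat.add_sub_cancel] at eA
    rw [hb, Nat.add_sub_cancel] at eB
    rw [hc, Nat.add_sub_cancel] at h1
    rw [hd, Nat.add_sub_cancel] at h2
    nlinarith
  · obtain ⟨c, hc⟩ : ∃ c, (A ∪ B).card = 2 * c + 1 := ⟨a + b - i, by omega⟩
    have h1 := hG _ ⟨c, hc⟩
    have h2 := hG _ ⟨i, hi⟩
    have h3 := card_innerEdges_add_le_union A B
    refine ⟨⟨c, hc⟩, le_antisymm h1 ?_⟩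
    have hs : a + b = c + i := by omega
    rw [ha, Nat.add_sub_cancel] at eA
    rw [hb, Nat.add_sub_cancel] at eB
    rw [hi, Nat.add_sub_cancel] at h2
    rw [hc, Nat.add_sub_cancel]
    nlinarith

lemma TightSet.exists_missing_notMem {k : ℕ} {B : Finset G.E}
    (hBcard : 2 * B.card = k * (Fintype.card G.V - 1))
    (hB : ∀ W : Finset G.V, Odd W.card →
      2 * (B ∩ G.innerEdges W).card ≤ k * (W.card - 1))
    (hE : 2 * Fintype.card G.E < (k + 1) * (Fintype.card G.V - 1))
    {W : Finset G.V} (hW : G.TightSet (k + 1) W) :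
    ∃ v, v ∉ W ∧ ∀ e, e ∉ B → v ∉ G.endFinset e := by
  have h1 := hB W hW.1
  have h2 := hW.2
  have h3 : (Bᶜ).card + B.card = Fintype.card G.E := Finset.card_compl_add_card B
  have h4 : (G.innerEdges W \ B).card + (B ∩ G.innerEdges W).card = (G.innerEdges W).card := by
    rw [Finset.inter_comm]; exact Finset.card_sdiff_add_card_inter _ _
  have h5 : (Bᶜ \ G.innerEdges W).card + (G.innerEdges W \ B).card = (Bᶜ).card := by
    rw [← Finset.card_sdiff_add_card_inter Bᶜ (G.innerEdges W)]
    congr 2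
    ext e
    simp [and_comm]
  have h6 := card_biUnion_endFinset_le (Bᶜ \ G.innerEdges W)
  have h7 := Finset.card_union_le W ((Bᶜ \ G.innerEdges W).biUnion G.endFinset)
  have hWpos := hW.1.pos
  have h8 : (W ∪ (Bᶜ \ G.innerEdges W).biUnion G.endFinset).card
      < (Finset.univ : Finset G.V).card := by
    rw [Finset.card_univ]
    rw [add_mul, one_mul] at h2 hE
    omega
  obtain ⟨v, -, hv⟩ := Finset.exists_mem_notMem_of_card_lt_card h8
  rw [Finset.mem_union, not_or] at hv
  refine ⟨v, hv.1, fun e he hve => hv.2 ?_⟩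
  refine Finset.mem_biUnion.2 ⟨e, ?_, hve⟩
  simp only [Finset.mem_sdiff, Finset.mem_compl, mem_innerEdges]
  exact ⟨he, fun h => hv.1 (h hve)⟩

lemma exists_total_coloring_of_tight
    {k : ℕ} (hodd : Odd (Fintype.card G.V)) (hdeg : ∀ v, G.degree v < k)
    (hE : 2 * Fintype.card G.E = k * (Fintype.card G.V - 1))
    {φ : G.E → Fin k} (hφ : G.IsProperEdgeColoring φ) :
    ∃ (cV : G.V → Fin k) (cE : G.E → Fin k), G.IsProperTotalColoring cV cE := by
  choose cV hcV using fun v => exists_missing φ (hdeg v)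
  have hle : ∀ c ∈ Finset.univ, 2 * (Finset.univ.filter fun e => φ e = c).card
      ≤ Fintype.card G.V - 1 := by
    intro c _
    have := card_color_innerEdges_le hφ (W := Finset.univ) (by simpa using hodd) c
    rwa [innerEdges_univ, Finset.card_univ] at this
  have hsum : ∑ c : Fin k, 2 * (Finset.univ.filter fun e => φ e = c).card
      = ∑ _c : Fin k, (Fintype.card G.V - 1) := by
    rw [← Finset.mul_sum, ← Finset.card_eq_sum_card_fiberwise (by simp [Set.MapsTo]),
      Finset.card_univ, hE]
    simp
  have heq := (Finset.sum_eq_sum_iff_of_le hle).1 hsum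
  refine ⟨cV, φ, hφ, ?_, fun v e hve h => hcV v e hve h.symm⟩
  rintro u v ⟨e, he⟩ huv
  have hne : u ≠ v := by
    rintro rfl
    exact G.loopless e (by simp [he])
  have hu := hcV u
  have hv := hcV v
  rw [← huv, mem_missing_iff] at hv
  rw [mem_missing_iff] at hu
  have h1 := card_biUnion_endFinset_color hφ Finset.univ (cV u)
  have h2 := heq (cV u) (Finset.mem_univ _)
  have h3 : (insert u (insert v ((Finset.univ.filter fun e => φ e = cV u).biUnion
      G.endFinset))).card ≤ Fintype.card G.V := Finset.card_le_univ _
  rw [Finset.card_insert_of_notMem (by simp only [Finset.mem_insert, not_or]; exact ⟨hne, hu⟩),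
    Finset.card_insert_of_notMem hv] at h3
  omega

/-- `addEdge` as a reducible definition, so that its vertex and edge types unfold. -/
abbrev insertEdge (G : Multigraph) (u v : G.V) (huv : u ≠ v) : Multigraph where
  V := G.V
  E := Option G.E
  fintypeV := G.fintypeV
  fintypeE := inferInstance
  decEqV := G.decEqV
  decEqE := inferInstance
  ends := fun e => e.elim s(u, v) G.ends
  loopless := fun e => (G.addEdge u v huv).loopless e

lemma card_innerEdges_insertEdge {u v : G.V} (huv : u ≠ v) (W : Finset G.V) :
    ((G.insertEdge u v huv).innerEdges W).card
      = (if u ∈ W ∧ v ∈ W then 1 else 0) + (G.innerEdges W).card := by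
  have hs : (s(u, v)).toFinset ⊆ W ↔ u ∈ W ∧ v ∈ W := by
    simp [Finset.subset_iff]
  rw [innerEdges, innerEdges, Finset.card_filter, Finset.card_filter]
  refine (Fintype.sum_option _).trans ?_
  congr 1
  exact if_congr hs rfl rfl

lemma degree_insertEdge {u v : G.V} (huv : u ≠ v) (w : G.V) :
    (G.insertEdge u v huv).degree w = (if w = u ∨ w = v then 1 else 0) + G.degree w := by
  rw [degree, degree, Finset.card_filter, Finset.card_filter]
  refine (Fintype.sum_option _).trans ?_
  congr 1
  exact if_congr Sym2.mem_iff rfl rfl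

/-- Edges outside `B` are added, with ends not yet met by such edges, until the edge
bound on the whole vertex set is attained. -/
lemma exists_total_coloring_of_base
    (GS : ∀ H : Multigraph, H.maxDegree + 2 ≤ H.chromaticIndex →
      H.chromaticIndex = ⌈H.density⌉₊) {k : ℕ} (m : ℕ) :
    ∀ (G : Multigraph) (B : Finset G.E), Odd (Fintype.card G.V) →
      2 * B.card = k * (Fintype.card G.V - 1) →
      (∀ v, (B.filter fun e => v ∈ G.endFinset e).card < k) →
      (∀ W : Finset G.V, Odd W.card → 2 * (B ∩ G.innerEdges W).card ≤ k * (W.card - 1)) →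
      (∀ v, G.degree v ≤ k) →
      (∀ W : Finset G.V, Odd W.card →
        2 * (G.innerEdges W).card ≤ (k + 1) * (W.card - 1)) →
      (k + 1) * (Fintype.card G.V - 1) ≤ 2 * Fintype.card G.E + m →
      ∃ (cV : G.V → Fin (k + 1)) (cE : G.E → Fin (k + 1)),
        G.IsProperTotalColoring cV cE := by
  induction m with
  | zero =>
    intro G B hodd _ _ _ hdeg hG hm
    obtain ⟨φ, hφ⟩ := exists_coloring_of_innerEdges_le GS hdeg hG
    have h := hG Finset.univ (by simpa using hodd)
    rw [innerEdges_univ, Finset.card_univ, Finset.card_univ] at h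
    exact exists_total_coloring_of_tight hodd (fun v => Nat.lt_succ_of_le (hdeg v))
      (le_antisymm h hm) hφ
  | succ m ih =>
    intro G B hodd hBcard hBdeg hB hdeg hG hm
    by_cases hE : (k + 1) * (Fintype.card G.V - 1) ≤ 2 * Fintype.card G.E
    · exact ih G B hodd hBcard hBdeg hB hdeg hG (by omega)
    push Not at hE
    have hfree : ∀ W : Finset G.V, G.TightSet (k + 1) W →
        ∃ v, v ∉ W ∧ ∀ e, e ∉ B → v ∉ G.endFinset e :=
      fun W hW => hW.exists_missing_notMem hBcard hB hE
    have hsingle : ∀ v : G.V, G.TightSet (k + 1) {v} := by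
      intro v
      refine ⟨by simp, ?_⟩
      have := hG {v} (by simp)
      simp at this ⊢
      exact this
    obtain ⟨w⟩ : Nonempty G.V := Fintype.card_pos_iff.1 hodd.pos
    obtain ⟨u, -, hu⟩ := hfree _ (hsingle w)
    obtain ⟨A, ⟨hA, huA⟩, hmax⟩ : ∃ A : Finset G.V, (G.TightSet (k + 1) A ∧ u ∈ A) ∧
        ∀ A' : Finset G.V, G.TightSet (k + 1) A' ∧ u ∈ A' → A'.card ≤ A.card := by
      classical
      obtain ⟨A, hA, hmax⟩ := Finset.exists_max_image
        (Finset.univ.filter fun A : Finset G.V => G.TightSet (k + 1) A ∧ u ∈ A) Finset.card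
        ⟨{u}, by simp [hsingle u]⟩
      exact ⟨A, by simpa using hA, fun A' hA' => hmax A' (by simpa using hA')⟩
    obtain ⟨v, hvA, hv⟩ := hfree A hA
    have huv : u ≠ v := by rintro rfl; exact hvA huA
    have hfreedeg : ∀ x, (∀ e, e ∉ B → x ∉ G.endFinset e) → G.degree x < k := by
      intro x hx
      refine lt_of_le_of_lt (Finset.card_le_card fun e he => ?_) (hBdeg x)
      have hxe : x ∈ G.endFinset e := mem_endFinset.2 (by simpa using he)
      exact Finset.mem_filter.2 ⟨by_contra fun h => hx e h hxe, hxe⟩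
    have hcardE : Fintype.card (G.insertEdge u v huv).E = Fintype.card G.E + 1 :=
      Fintype.card_option
    have hinner : ∀ W : Finset G.V,
        (B.map Function.Embedding.some : Finset (G.insertEdge u v huv).E) ∩
          (G.insertEdge u v huv).innerEdges W
          = (B ∩ G.innerEdges W).map Function.Embedding.some := by
      intro W
      have hsome : ∀ f : G.E, (some f : (G.insertEdge u v huv).E) ∈
          (G.insertEdge u v huv).innerEdges W ↔ f ∈ G.innerEdges W := by
        intro f
        rw [mem_innerEdges, mem_innerEdges]
        rfl
      ext e
      simp only [Finset.mem_inter, Finset.mem_map]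
      constructor
      · rintro ⟨⟨f, hf, rfl⟩, hfW⟩
        exact ⟨f, ⟨hf, (hsome f).1 hfW⟩, rfl⟩
      · rintro ⟨f, ⟨hf, hfW⟩, rfl⟩
        exact ⟨⟨f, hf, rfl⟩, (hsome f).2 hfW⟩
    obtain ⟨cV, cE, h1, h2, h3⟩ := ih (G.insertEdge u v huv)
      (B.map Function.Embedding.some) hodd
      (by rw [Finset.card_map]; exact hBcard)
      (by
        intro x
        rw [Finset.filter_map, Finset.card_map]
        exact hBdeg x)
      (by
        intro W hW
        rw [hinner, Finset.card_map]
        exact hB W hW)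
      (by
        intro x
        rw [degree_insertEdge]
        split_ifs with hx
        · have : G.degree x < k :=
            hx.elim (fun h => h.symm ▸ hfreedeg u hu) (fun h => h.symm ▸ hfreedeg v hv)
          omega
        · simpa using hdeg x)
      (by
        intro W hW
        rw [card_innerEdges_insertEdge]
        split_ifs with huvW
        · have hlt : 2 * (G.innerEdges W).card ≠ (k + 1) * (W.card - 1) := by
            intro heq
            have ht := TightSet.union hdeg hG hA ⟨hW, heq⟩
              ⟨u, Finset.mem_inter.2 ⟨huA, huvW.1⟩⟩
            have hc := hmax _ ⟨ht, Finset.mem_union_left _ huA⟩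
            have := Finset.eq_of_subset_of_card_le Finset.subset_union_left hc
            exact hvA (this ▸ Finset.mem_union_right _ huvW.2)
          have hle := hG W hW
          obtain ⟨a, ha⟩ := hW
          rw [ha, Nat.add_sub_cancel, Nat.mul_left_comm] at hlt hle ⊢
          omega
        · simpa using hG W hW)
      (by
        rw [hcardE]
        change (k + 1) * (Fintype.card G.V - 1) ≤ _
        omega)
    refine ⟨cV, fun e => cE (some e), ?_, ?_, fun x e hx => h3 x (some e) hx⟩
    · exact fun e f hef hx => h1 (some e) (some f) (fun h => hef (Option.some.inj h)) hx
    · rintro x y ⟨e, he⟩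
      exact h2 x y ⟨some e, he⟩

lemma odd_card_of_elementary {k : ℕ} {φ : G.E → Fin k} (hφ : G.IsProperEdgeColoring φ)
    (hel : G.Elementary φ Set.univ) (hdeg : ∀ v, G.degree v < k) [Nonempty G.V] :
    Odd (Fintype.card G.V) ∧ 2 * Fintype.card G.E = k * (Fintype.card G.V - 1) := by
  have hc : ∀ c : Fin k, Fintype.card G.V - 1 ≤ 2 * (Finset.univ.filter fun e => φ e = c).card := by
    intro c
    rw [← card_biUnion_endFinset_color hφ]
    have h1 : (((Finset.univ.filter fun e => φ e = c).biUnion G.endFinset)ᶜ).card ≤ 1 := by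
      refine Finset.card_le_one.2 fun u hu v hv => by_contra fun huv => ?_
      rw [Finset.mem_compl, ← mem_missing_iff] at hu hv
      exact Set.disjoint_left.1 (hel u trivial v trivial huv) hu hv
    have h2 := Finset.card_compl_add_card
      ((Finset.univ.filter fun e => φ e = c).biUnion G.endFinset)
    omega
  have hodd : Odd (Fintype.card G.V) := by
    obtain ⟨v⟩ := ‹Nonempty G.V›
    obtain ⟨c, hcv⟩ := exists_missing φ (hdeg v)
    rw [mem_missing_iff] at hcv
    have h1 := Finset.card_lt_univ_of_notMem hcv
    have h2 := hc c
    rw [card_biUnion_endFinset_color hφ] at h1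
    exact ⟨(Finset.univ.filter fun e => φ e = c).card, by omega⟩
  refine ⟨hodd, le_antisymm ?_ ?_⟩
  · have := two_mul_card_innerEdges_le hφ (W := Finset.univ) (by simpa using hodd)
    rwa [innerEdges_univ, Finset.card_univ, Finset.card_univ] at this
  · rw [← Finset.card_univ (α := G.E),
      Finset.card_eq_sum_card_fiberwise (f := φ) (t := Finset.univ) (by simp [Set.MapsTo]), Finset.mul_sum]
    calc _ = ∑ _c : Fin k, (Fintype.card G.V - 1) := by simp
      _ ≤ _ := Finset.sum_le_sum fun c _ => hc c

lemma IsSpanningSubgraph.deleteEdge {H : Multigraph} (h : IsSpanningSubgraph H G) (e : H.E) :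
    IsSpanningSubgraph (H.deleteEdge e) G := by
  obtain ⟨f, g, hf, hg, hfg⟩ := h
  exact ⟨f, fun x => g x.1, hf, hg.comp Subtype.val_injective, fun x => hfg x.1⟩

lemma IsSpanningSubgraph.exists_degree_le {H : Multigraph} (h : IsSpanningSubgraph H G)
    (v : H.V) : ∃ w, H.degree v ≤ G.degree w := by
  obtain ⟨f, g, -, hg, hfg⟩ := h
  refine ⟨f v, Finset.card_le_card_of_injOn g (fun e he => ?_) hg.injOn⟩
  simp only [Finset.mem_coe, Finset.mem_filter, Finset.mem_univ, true_and] at he ⊢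
  rw [hfg, Sym2.mem_map]
  exact ⟨v, he, rfl⟩

lemma exists_total_coloring_of_elementary
    (GS : ∀ H : Multigraph, H.maxDegree + 2 ≤ H.chromaticIndex →
      H.chromaticIndex = ⌈H.density⌉₊) {k : ℕ} {H : Multigraph} [Nonempty H.V]
    (h : IsSpanningSubgraph H G) {φ : H.E → Fin k} (hφ : H.IsProperEdgeColoring φ)
    (hel : H.Elementary φ Set.univ) (hdeg : ∀ v, G.degree v < k)
    {ψ : G.E → Fin (k + 1)} (hψ : G.IsProperEdgeColoring ψ) :
    ∃ (cV : G.V → Fin (k + 1)) (cE : G.E → Fin (k + 1)),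
      G.IsProperTotalColoring cV cE := by
  have hHdeg : ∀ v, H.degree v < k := fun v =>
    let ⟨w, hw⟩ := h.exists_degree_le v
    hw.trans_lt (hdeg w)
  obtain ⟨hodd, hcard⟩ := odd_card_of_elementary hφ hel hHdeg
  obtain ⟨f, g, hf, hg, hfg⟩ := h
  rw [Fintype.card_of_bijective hf] at hodd hcard
  refine exists_total_coloring_of_base GS _ G (Finset.univ.map ⟨g, hg⟩) hodd ?_ ?_ ?_
    (fun v => (hdeg v).le) (fun W hW => two_mul_card_innerEdges_le hψ hW)
    (Nat.le_add_left _ _)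
  · rw [Finset.card_map, Finset.card_univ, hcard]
  · intro v
    refine lt_of_le_of_lt (Finset.card_le_card fun e he => ?_) (hdeg v)
    simpa [mem_endFinset] using (Finset.mem_filter.1 he).2
  · intro W hW
    obtain ⟨σ, hσ⟩ : ∃ σ : H.V ≃ G.V, ⇑σ = f := ⟨Equiv.ofBijective f hf, rfl⟩
    have hWc : (W.map σ.symm.toEmbedding).card = W.card := Finset.card_map _
    have h1 := two_mul_card_innerEdges_le hφ (W := W.map σ.symm.toEmbedding) (by rwa [hWc])
    rw [hWc] at h1
    refine le_trans (Nat.mul_le_mul_left 2 ?_) h1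
    rw [← Finset.card_map ⟨g, hg⟩]
    refine Finset.card_le_card fun e' he' => ?_
    obtain ⟨he, heW⟩ := Finset.mem_inter.1 he'
    obtain ⟨e, -, rfl⟩ := Finset.mem_map.1 he
    refine Finset.mem_map_of_mem _ (mem_innerEdges.2 fun v hv => ?_)
    have hfv : f v ∈ W := by
      refine mem_innerEdges.1 heW (mem_endFinset.2 ?_)
      change f v ∈ G.ends (g e)
      rw [hfg, Sym2.mem_map]
      exact ⟨v, mem_endFinset.1 hv, rfl⟩
    exact Finset.mem_map.2 ⟨f v, hfv, by simp [← hσ]⟩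

end

end Multigraph


/-- Assuming Goldberg–Seymour and the elementary-coloring property of
edge-chromatic critical multigraphs, if `G` has χ'(G) ≥ Δ(G)+2 and a spanning
edge-chromatic critical subgraph `H` with χ'(H) = χ'(G), then χ''(G) = χ'(G). -/
theorem total_eq_chromaticIndex_of_spanning_critical_subgraph
    (GS : ∀ H : Multigraph, H.maxDegree + 2 ≤ H.chromaticIndex →
      H.chromaticIndex = ⌈H.density⌉₊)
    (TC : ∀ H : Multigraph, H.EdgeChromaticCritical →
      H.maxDegree + 2 ≤ H.chromaticIndex → ∀ e : H.E,
      ∃ φ : (H.deleteEdge e).E → Fin (H.chromaticIndex - 1),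
        (H.deleteEdge e).IsProperEdgeColoring φ ∧
        (H.deleteEdge e).Elementary φ Set.univ)
    (G H : Multigraph)
    (hGΔ : G.maxDegree + 2 ≤ G.chromaticIndex)
    (hsub : IsSpanningSubgraph H G)
    (hcrit : H.EdgeChromaticCritical)
    (hchi : H.chromaticIndex = G.chromaticIndex) :
    G.totalChromaticNumber = G.chromaticIndex := by
  obtain ⟨k, hk⟩ : ∃ k, G.chromaticIndex = k + 1 := ⟨_, (Nat.succ_pred (by omega)).symm⟩
  have hdeg : ∀ v, G.degree v < k := fun v => by
    have := G.degree_le_maxDegree v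
    omega
  have hHΔ : H.maxDegree + 2 ≤ H.chromaticIndex := by
    have : H.maxDegree ≤ G.maxDegree := Finset.sup_le fun v _ =>
      let ⟨w, hw⟩ := hsub.exists_degree_le v
      hw.trans (G.degree_le_maxDegree w)
    omega
  obtain ⟨e⟩ : Nonempty H.E := by
    by_contra hne
    rw [not_nonempty_iff] at hne
    have : H.chromaticIndex ≤ 0 :=
      chromaticIndex_le (φ := fun e => hne.elim e) (fun e => hne.elim e)
    omega
  have hTC := TC H hcrit hHΔ e
  rw [show H.chromaticIndex - 1 = k by omega] at hTC
  obtain ⟨φ, hφ, hel⟩ := hTC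
  obtain ⟨ψ, hψ⟩ := exists_coloring_of_chromaticIndex_le hk.le
  have : Nonempty (H.deleteEdge e).V := ⟨(H.ends e).out.1⟩
  have htot := exists_total_coloring_of_elementary GS (hsub.deleteEdge e) hφ hel hdeg hψ
  rw [← hk] at htot
  refine le_antisymm (Nat.sInf_le htot) ?_
  obtain ⟨cV, cE, hc⟩ := Nat.sInf_mem (s := {k | ∃ (cV : G.V → Fin k) (cE : G.E → Fin k),
    G.IsProperTotalColoring cV cE}) ⟨_, htot⟩
  exact chromaticIndex_le hc.1
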